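/- Let r₁ = p₁/q₁ and r₂ = p₂/q₂ be distinct rational numbers in lowest terms with |r₁| > 2, |r₂| > 2, and d₁(r₁,r₂) + d₂(r₁,r₂) < 2π. Let C ⊆ ℝ² be a closed set such that: (a) C is invariant under the translations (θ,η) ↦ (θ+π, η) and (θ,η) ↦ (θ, η+2π); (b) there exists ε > 0 such that every (θ,η) ∈ C with |θ − kπ| ≤ ε for some integer k satisfies η ∈ 2πℤ; (c) every (θ,η) ∈ C ∩ (S(r₁) ∪ S(r₂)) satisfies η ∈ 2πℤ. Then there exist smooth, odd, 2π-periodic functions g₁, g₂ : ℝ → ℝ with |g₂| < π everywhere, such that for every (θ,η) ∈ C one has η − π ≠ g₂(θ + g₁(η − π)). -/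

import Mathlib

open Real

/-- The set `S(p/q) = {(θ,η) : pθ+qη ∈ 2πℤ or pθ+pπ+qη ∈ 2πℤ}`. -/
def Spq (p q : ℤ) : Set (ℝ × ℝ) :=
  {x | (∃ k : ℤ, (p : ℝ) * x.1 + (q : ℝ) * x.2 = 2 * π * k) ∨
       (∃ k : ℤ, (p : ℝ) * x.1 + (p : ℝ) * π + (q : ℝ) * x.2 = 2 * π * k)}

/-- The set `Ŝ(p/q) = {(θ,η) : pθ+qη ∈ πℤ}`. -/
def Shat (p q : ℤ) : Set (ℝ × ℝ) :=
  {x | ∃ k : ℤ, (p : ℝ) * x.1 + (q : ℝ) * x.2 = π * k}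

/-- The open strip `W* = ℝ × (0, 2π)`. -/
def Wstar : Set (ℝ × ℝ) :=
  {x | 0 < x.2 ∧ x.2 < 2 * π}

/-- Two points `a ≠ b` are adjacent in `L` relative to the set `X` of intersection points:
they lie on the same connected component of `L` and no point of `X` lies strictly
between them. -/
def AdjacentIn (L X : Set (ℝ × ℝ)) (a b : ℝ × ℝ) : Prop :=
  a ≠ b ∧ b ∈ connectedComponentIn L a ∧ ∀ c ∈ X, c ∉ openSegment ℝ a b

/-- The quantity `d₁(r₁,r₂)` of the paper, where `r₁ = p₁/q₁` and `r₂ = p₂/q₂`: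
`2π|p₁|/Δ(r₁,r₂)` if `p₂` is even, and `π|p₁|/Δ(r₁,r₂)` if `p₂` is odd
(`d₂(r₁,r₂)` is obtained by swapping the roles of the two fractions). -/
noncomputable def dd (p₁ q₁ p₂ q₂ : ℤ) : ℝ :=
  if Even p₂ then 2 * π * |(p₁ : ℝ)| / |((p₁ * q₂ - p₂ * q₁ : ℤ) : ℝ)|
  else π * |(p₁ : ℝ)| / |((p₁ * q₂ - p₂ * q₁ : ℤ) : ℝ)|

open Polynomial in
/-- A continuous function on `[0, π]` vanishing at the endpoints is uniformly approximated there
by functions `x ↦ sin x * P (cos x)`, which are smooth, odd and `2π`-periodic. -/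
lemma exists_smooth_odd_periodic_near (f : ℝ → ℝ) (hf : Continuous f) (h0 : f 0 = 0)
    (hpi : f π = 0) {δ : ℝ} (hδ : 0 < δ) :
    ∃ g : ℝ → ℝ, ContDiff ℝ (⊤ : ℕ∞) g ∧ (∀ x, g (-x) = -g x) ∧
      Function.Periodic g (2 * π) ∧ ∀ x ∈ Set.Icc 0 π, |g x - f x| < δ := by
  obtain ⟨c, hc, hfc⟩ : ∃ c > 0, ∀ x ∈ Set.Icc 0 π, sin x < c → |f x| < δ / 2 := by
    have hK : IsCompact (Set.Icc 0 π ∩ {x | δ / 2 ≤ |f x|}) :=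
      isCompact_Icc.inter_right (isClosed_le continuous_const hf.abs)
    rcases Set.eq_empty_or_nonempty (Set.Icc 0 π ∩ {x | δ / 2 ≤ |f x|}) with h | h
    · refine ⟨1, one_pos, fun x hx _ => ?_⟩
      by_contra! hcon
      exact (h ▸ (⟨hx, hcon⟩ : x ∈ Set.Icc 0 π ∩ {x | δ / 2 ≤ |f x|}) : x ∈ (∅ : Set ℝ))
    · obtain ⟨x₀, ⟨hx₀, hfx₀⟩, hmin⟩ := hK.exists_isMinOn h continuous_sin.continuousOn
      have hfx₀' : 0 < |f x₀| := lt_of_lt_of_le (by positivity) hfx₀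
      have hne0 : x₀ ≠ 0 := by rintro rfl; simp [h0] at hfx₀'
      have hnepi : x₀ ≠ π := by rintro rfl; simp [hpi] at hfx₀'
      refine ⟨sin x₀, sin_pos_of_pos_of_lt_pi (lt_of_le_of_ne hx₀.1 hne0.symm)
        (lt_of_le_of_ne hx₀.2 hnepi), fun x hx hlt => ?_⟩
      by_contra! hcon
      exact absurd (hmin (show x ∈ Set.Icc 0 π ∩ {x | δ / 2 ≤ |f x|} from ⟨hx, hcon⟩))
        (not_le.mpr hlt)
  have hmaxpos : ∀ s : ℝ, 0 < max s c := fun s => lt_max_of_lt_right hc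
  have hQ : Continuous fun t : ℝ => f (arccos t) / max (√(1 - t ^ 2)) c :=
    (hf.comp continuous_arccos).div
      ((continuous_sqrt.comp (by fun_prop)).max continuous_const) fun t => (hmaxpos _).ne'
  obtain ⟨P, hP⟩ := exists_polynomial_near_of_continuousOn (-1) 1 _ hQ.continuousOn (δ / 2)
    (by positivity)
  refine ⟨fun x => sin x * P.eval (cos x), ?_, fun x => by simp, fun x => by simp,
    fun x hx => ?_⟩
  · simpa using contDiff_sin.mul ((P.contDiff_aeval (⊤ : ℕ∞)).comp contDiff_cos)
  have hP' := hP (cos x) ⟨neg_one_le_cos x, cos_le_one x⟩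
  have hs0 : 0 ≤ sin x := sin_nonneg_of_mem_Icc hx
  have hsq : √(1 - cos x ^ 2) = sin x := by
    rw [← sin_sq, sqrt_sq hs0]
  simp only [arccos_cos hx.1 hx.2, hsq] at hP'
  have h1 : |sin x * P.eval (cos x) - sin x * (f x / max (sin x) c)| < δ / 2 := by
    rw [← mul_sub, abs_mul, abs_of_nonneg hs0]
    calc sin x * _ ≤ 1 * _ := mul_le_mul_of_nonneg_right (sin_le_one x) (abs_nonneg _)
      _ < δ / 2 := by rwa [one_mul]
  have h2 : |sin x * (f x / max (sin x) c) - f x| < δ / 2 := by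
    rcases le_or_gt c (sin x) with h | h
    · rw [max_eq_left h, mul_div_cancel₀ _ (hc.trans_le h).ne']
      simpa using hδ
    · rw [max_eq_right h.le]
      have : sin x * (f x / c) - f x = -((1 - sin x / c) * f x) := by ring
      have hr0 : 0 ≤ sin x / c := by positivity
      have hr1 : sin x / c ≤ 1 := (div_le_one hc).mpr h.le
      rw [this, abs_neg, abs_mul, abs_of_nonneg (by linarith)]
      exact (mul_le_of_le_one_left (abs_nonneg _) (by linarith)).trans_lt (hfc x hx h)
  calc _ ≤ _ := abs_sub_le _ (sin x * (f x / max (sin x) c)) _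
    _ < δ := by linarith

/-- `P` and `Q` are joined inside `U` by a path that is a graph over the sheared coordinate
`x = θ + κ y`. -/
def ShearedGraphJoined (κ : ℝ) (U : Set (ℝ × ℝ)) (P Q : ℝ × ℝ) : Prop :=
  P.1 + κ * P.2 ≤ Q.1 + κ * Q.2 ∧ ∃ f : ℝ → ℝ, Continuous f ∧ f (P.1 + κ * P.2) = P.2 ∧
    f (Q.1 + κ * Q.2) = Q.2 ∧
    ∀ x ∈ Set.Icc (P.1 + κ * P.2) (Q.1 + κ * Q.2), (x - κ * f x, f x) ∈ U

namespace ShearedGraphJoined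

variable {κ : ℝ} {U : Set (ℝ × ℝ)} {P Q R : ℝ × ℝ}

lemma refl (hP : P ∈ U) : ShearedGraphJoined κ U P P := by
  refine ⟨le_rfl, fun _ => P.2, continuous_const, rfl, rfl, fun x hx => ?_⟩
  have : x = P.1 + κ * P.2 := le_antisymm hx.2 hx.1
  simpa [this] using hP

lemma trans (h₁ : ShearedGraphJoined κ U P Q) (h₂ : ShearedGraphJoined κ U Q R) :
    ShearedGraphJoined κ U P R := by
  obtain ⟨hle, f, hf, hfP, hfQ, hfU⟩ := h₁
  obtain ⟨hle', g, hg, hgQ, hgR, hgU⟩ := h₂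
  refine ⟨hle.trans hle', fun x => if x ≤ Q.1 + κ * Q.2 then f x else g x,
    Continuous.if_le hf hg continuous_id continuous_const ?_, ?_, ?_, fun x hx => ?_⟩
  · rintro x rfl
    exact hfQ.trans hgQ.symm
  · simp [hle, hfP]
  · dsimp only
    split_ifs with h
    · have : R.1 + κ * R.2 = Q.1 + κ * Q.2 := le_antisymm h hle'
      rw [this, hfQ, ← hgQ, ← this, hgR]
    · exact hgR
  · dsimp only
    split_ifs with h
    · exact hfU x ⟨hx.1, h⟩
    · exact hgU x ⟨(not_le.mp h).le, hx.2⟩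

lemma of_segment (hlt : P.1 + κ * P.2 < Q.1 + κ * Q.2)
    (hU : ∀ t ∈ Set.Icc (0 : ℝ) 1, (P.1 + t * (Q.1 - P.1), P.2 + t * (Q.2 - P.2)) ∈ U) :
    ShearedGraphJoined κ U P Q := by
  have hpos : 0 < Q.1 + κ * Q.2 - (P.1 + κ * P.2) := sub_pos.mpr hlt
  refine ⟨hlt.le, fun x => P.2 + (x - (P.1 + κ * P.2)) /
    (Q.1 + κ * Q.2 - (P.1 + κ * P.2)) * (Q.2 - P.2), by fun_prop, by simp, ?_, fun x hx => ?_⟩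
  · simp [div_self hpos.ne']
  · have ht := hU ((x - (P.1 + κ * P.2)) / (Q.1 + κ * Q.2 - (P.1 + κ * P.2)))
      ⟨div_nonneg (sub_nonneg.mpr hx.1) hpos.le,
        (div_le_one hpos).mpr (sub_le_sub_right hx.2 _)⟩
    convert ht using 2
    field_simp
    ring

/-- Central symmetry about `(π / 2, 0)` reverses joins. -/
lemma reflect (hU : ∀ θ y, (θ, y) ∈ U → (π - θ, -y) ∈ U) (h : ShearedGraphJoined κ U P Q) :
    ShearedGraphJoined κ U (π - Q.1, -Q.2) (π - P.1, -P.2) := by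
  obtain ⟨hle, f, hf, hfP, hfQ, hfU⟩ := h
  refine ⟨by dsimp only; linarith, fun x => -f (π - x), by fun_prop, ?_, ?_, fun x hx => ?_⟩
  · dsimp only
    rw [← hfQ]
    congr 2
    rw [hfQ]
    ring
  · dsimp only
    rw [← hfP]
    congr 2
    rw [hfP]
    ring
  · have := hU _ _ (hfU (π - x) ⟨by linarith [hx.2], by linarith [hx.1]⟩)
    convert this using 2
    ring

end ShearedGraphJoined

/-- A monotone lattice walk whose upward steps have height `A` and whose downward steps have
height `B` can be ordered so as to stay in the strip `|h| < D`, provided `A + B < 2 * D`. -/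
lemma lattice_walk (r : ℤ × ℤ → ℤ × ℤ → Prop) (p₁ p₂ m₁ m₂ D : ℤ)
    (hp₁ : 0 < p₁) (hp₂ : 0 < p₂) (hm₁ : 0 < m₁) (hm₂ : 0 < m₂)
    (hsum : p₁ * m₂ + p₂ * m₁ < 2 * D) (good : ℤ × ℤ → Prop)
    (hgood₁ : ∀ w, good w → good (w.1 + m₁, w.2)) (hgood₂ : ∀ w, good w → good (w.1, w.2 + m₂))
    (hrefl : ∀ w, good w → |p₁ * w.2 - p₂ * w.1| < D → r w w)
    (htrans : ∀ a b c, r a b → r b c → r a c)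
    (hup : ∀ w, good w → |p₁ * w.2 - p₂ * w.1| < D →
      |p₁ * (w.2 + m₂) - p₂ * w.1| < D → r w (w.1, w.2 + m₂))
    (hdown : ∀ w, good w → |p₁ * w.2 - p₂ * w.1| < D →
      |p₁ * w.2 - p₂ * (w.1 + m₁)| < D → r w (w.1 + m₁, w.2)) :
    ∀ n i j : ℕ, i + j = n → ∀ w, good w → |p₁ * w.2 - p₂ * w.1| < D →
      |p₁ * (w.2 + m₂ * i) - p₂ * (w.1 + m₁ * j)| < D →
      r w (w.1 + m₁ * j, w.2 + m₂ * i) := by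
  have hA : 0 < p₁ * m₂ := by positivity
  have hB : 0 < p₂ * m₁ := by positivity
  intro n
  induction n with
  | zero =>
    intro i j hij w hw h _
    obtain ⟨rfl, rfl⟩ : i = 0 ∧ j = 0 := by omega
    simpa using hrefl w hw h
  | succ n ih =>
    intro i j hij w hw h h'
    have up : ∀ i', i = i' + 1 → |p₁ * (w.2 + m₂) - p₂ * w.1| < D →
        r w (w.1 + m₁ * j, w.2 + m₂ * i) := by
      rintro i' rfl hs
      have key := ih i' j (by omega) (w.1, w.2 + m₂) (hgood₂ w hw) hs
        (by convert h' using 2; push_cast; ring)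
      refine htrans _ _ _ (hup w hw h hs) ?_
      convert key using 2
      push_cast
      ring
    have down : ∀ j', j = j' + 1 → |p₁ * w.2 - p₂ * (w.1 + m₁)| < D →
        r w (w.1 + m₁ * j, w.2 + m₂ * i) := by
      rintro j' rfl hs
      have key := ih i j' (by omega) (w.1 + m₁, w.2) (hgood₁ w hw) hs
        (by convert h' using 2; push_cast; ring)
      refine htrans _ _ _ (hdown w hw h hs) ?_
      convert key using 2
      push_cast
      ring
    rw [abs_lt] at h h'
    rcases i with _ | i
    · obtain ⟨j, rfl⟩ : ∃ j', j = j' + 1 := ⟨n, by omega⟩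
      refine down j rfl ?_
      have : 0 ≤ p₂ * m₁ * (j : ℤ) := by positivity
      push_cast at h'
      rw [abs_lt]
      constructor <;> nlinarith
    rcases j with _ | j
    · refine up i rfl ?_
      have : 0 ≤ p₁ * m₂ * (i : ℤ) := by positivity
      push_cast at h'
      rw [abs_lt]
      constructor <;> nlinarith
    by_cases hc : p₁ * (w.2 + m₂) - p₂ * w.1 < D
    · refine up i rfl ?_
      rw [abs_lt]
      constructor <;> nlinarith
    · refine down j rfl ?_
      rw [abs_lt]
      constructor <;> nlinarith

/-- The point `(θ, y)` with `(p₁ θ + q₁ y, p₂ θ + q₂ y) = (π u, π v)`. -/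
noncomputable def linePoint (p₁ q₁ p₂ q₂ : ℤ) (u v : ℝ) : ℝ × ℝ :=
  (π * (q₂ * u - q₁ * v) / (p₁ * q₂ - p₂ * q₁), π * (p₁ * v - p₂ * u) / (p₁ * q₂ - p₂ * q₁))

/-- A symmetric set containing the relevant lines of two slopes and the axis `θ = 0` in the
strip `|y| < π`. -/
structure ContainsLines (p₁ q₁ p₂ q₂ : ℤ) (U : Set (ℝ × ℝ)) : Prop where
  reflect : ∀ θ y, (θ, y) ∈ U → (π - θ, -y) ∈ U
  line₁ : ∀ θ y, |y| < π → ∀ k : ℤ, p₁ * θ + q₁ * y = π * k → (Even p₁ → Odd k) → (θ, y) ∈ U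
  line₂ : ∀ θ y, |y| < π → ∀ k : ℤ, p₂ * θ + q₂ * y = π * k → (Even p₂ → Odd k) → (θ, y) ∈ U
  axis : ∀ y, |y| < π → (0, y) ∈ U

section Lines

variable {p₁ q₁ p₂ q₂ : ℤ} {U : Set (ℝ × ℝ)} {κ : ℝ}

lemma linePoint_first (hD : (0 : ℝ) < p₁ * q₂ - p₂ * q₁) (u v : ℝ) :
    p₁ * (linePoint p₁ q₁ p₂ q₂ u v).1 + q₁ * (linePoint p₁ q₁ p₂ q₂ u v).2 = π * u := by
  have := hD.ne'
  simp only [linePoint]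
  rw [mul_div_assoc', mul_div_assoc', ← add_div, div_eq_iff this]
  ring

lemma linePoint_second (hD : (0 : ℝ) < p₁ * q₂ - p₂ * q₁) (u v : ℝ) :
    p₂ * (linePoint p₁ q₁ p₂ q₂ u v).1 + q₂ * (linePoint p₁ q₁ p₂ q₂ u v).2 = π * v := by
  have := hD.ne'
  simp only [linePoint]
  rw [mul_div_assoc', mul_div_assoc', ← add_div, div_eq_iff this]
  ring

lemma linePoint_shear_sub (u v u' v' : ℝ) :
    ((linePoint p₁ q₁ p₂ q₂ u' v').1 + κ * (linePoint p₁ q₁ p₂ q₂ u' v').2) -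
      ((linePoint p₁ q₁ p₂ q₂ u v).1 + κ * (linePoint p₁ q₁ p₂ q₂ u v).2) =
    π * ((q₂ - κ * p₂) * (u' - u) + (κ * p₁ - q₁) * (v' - v)) / (p₁ * q₂ - p₂ * q₁) := by
  simp only [linePoint]
  ring

lemma abs_linePoint_snd_lt (hD : (0 : ℝ) < p₁ * q₂ - p₂ * q₁) {u v : ℝ}
    (h : |p₁ * v - p₂ * u| < p₁ * q₂ - p₂ * q₁) : |(linePoint p₁ q₁ p₂ q₂ u v).2| < π := by
  simp only [linePoint]
  rw [abs_div, abs_mul, abs_of_pos hD, abs_of_pos pi_pos, div_lt_iff₀ hD]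
  exact mul_lt_mul_of_pos_left h pi_pos

lemma abs_add_mul_sub_lt {a b c t : ℝ} (ha : |a| < c) (hb : |b| < c) (ht : t ∈ Set.Icc (0 : ℝ) 1) :
    |a + t * (b - a)| < c := by
  have h := (convex_Ioo (-c) c).add_smul_sub_mem (abs_lt.mp ha) (abs_lt.mp hb) ht
  exact abs_lt.mpr h

lemma ContainsLines.joined_up (hU : ContainsLines p₁ q₁ p₂ q₂ U)
    (hD : (0 : ℝ) < p₁ * q₂ - p₂ * q₁) (hκ₁ : (q₁ : ℝ) < κ * p₁) (k : ℤ) (hk : Even p₁ → Odd k)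
    {v v' : ℝ} (hv : v ≤ v') (h : |p₁ * v - p₂ * k| < (p₁ * q₂ - p₂ * q₁ : ℝ))
    (h' : |p₁ * v' - p₂ * k| < (p₁ * q₂ - p₂ * q₁ : ℝ)) :
    ShearedGraphJoined κ U (linePoint p₁ q₁ p₂ q₂ k v) (linePoint p₁ q₁ p₂ q₂ k v') := by
  have hy := abs_linePoint_snd_lt hD h
  have hy' := abs_linePoint_snd_lt hD h'
  have e := linePoint_first hD k v
  have e' := linePoint_first hD k v'
  rcases hv.eq_or_lt with rfl | hlt
  · exact .refl (hU.line₁ _ _ hy k e hk)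
  refine .of_segment ?_ fun t ht => hU.line₁ _ _ (abs_add_mul_sub_lt hy hy' ht) k ?_ hk
  · rw [← sub_pos, linePoint_shear_sub]
    have : 0 < (κ * p₁ - q₁) * (v' - v) := mul_pos (by linarith) (by linarith)
    rw [sub_self, mul_zero, zero_add]
    positivity
  · linear_combination (1 - t) * e + t * e'

lemma ContainsLines.joined_down (hU : ContainsLines p₁ q₁ p₂ q₂ U)
    (hD : (0 : ℝ) < p₁ * q₂ - p₂ * q₁) (hκ₂ : κ * p₂ < q₂) (k : ℤ) (hk : Even p₂ → Odd k)
    {u u' : ℝ} (hu : u ≤ u') (h : |p₁ * k - p₂ * u| < (p₁ * q₂ - p₂ * q₁ : ℝ))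
    (h' : |p₁ * k - p₂ * u'| < (p₁ * q₂ - p₂ * q₁ : ℝ)) :
    ShearedGraphJoined κ U (linePoint p₁ q₁ p₂ q₂ u k) (linePoint p₁ q₁ p₂ q₂ u' k) := by
  have hy := abs_linePoint_snd_lt hD h
  have hy' := abs_linePoint_snd_lt hD h'
  have e := linePoint_second hD u k
  have e' := linePoint_second hD u' k
  rcases hu.eq_or_lt with rfl | hlt
  · exact .refl (hU.line₂ _ _ hy k e hk)
  refine .of_segment ?_ fun t ht => hU.line₂ _ _ (abs_add_mul_sub_lt hy hy' ht) k ?_ hk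
  · rw [← sub_pos, linePoint_shear_sub]
    have : 0 < (q₂ - κ * p₂) * (u' - u) := mul_pos (by linarith) (by linarith)
    rw [sub_self, mul_zero, add_zero]
    positivity
  · linear_combination (1 - t) * e + t * e'

lemma ContainsLines.joined_axis (hU : ContainsLines p₁ q₁ p₂ q₂ U)
    {s : ℝ} (hs : |s| < 1) (hκs : 0 < κ * s) :
    ShearedGraphJoined κ U (0, 0) (0, π * s) := by
  refine .of_segment ?_ fun t ht => ?_
  · have := pi_pos
    have : 0 < π * (κ * s) := by positivity
    dsimp only
    linarith
  · have := abs_add_mul_sub_lt (a := 0) (b := π * s) (c := π) (by simpa using pi_pos) (by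
      rw [abs_mul, abs_of_pos pi_pos]
      exact mul_lt_of_lt_one_right pi_pos hs) ht
    simpa using hU.axis _ this

lemma linePoint_axis (hD : (0 : ℝ) < p₁ * q₂ - p₂ * q₁) (s : ℝ) :
    linePoint p₁ q₁ p₂ q₂ (q₁ * s) (q₂ * s) = (0, π * s) := by
  have := hD.ne'
  simp only [linePoint]
  ext
  · simp only
    rw [div_eq_zero_iff]
    left
    ring
  · simp only
    field_simp

/-- When both numerators are even, the origin is joined to the lattice point `(1, 1)` by first
following the axis `θ = 0`. -/
lemma ContainsLines.exists_joined_one_one (hU : ContainsLines p₁ q₁ p₂ q₂ U)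
    (hp₁ : 0 < p₁) (hp₂ : 0 < p₂) (hsum : p₁ + p₂ < p₁ * q₂ - p₂ * q₁) :
    ∃ κ : ℝ, q₁ < κ * p₁ ∧ κ * p₂ < q₂ ∧
      ShearedGraphJoined κ U (0, 0) (linePoint p₁ q₁ p₂ q₂ 1 1) := by
  have hp₁' : (0 : ℝ) < p₁ := by exact_mod_cast hp₁
  have hp₂' : (0 : ℝ) < p₂ := by exact_mod_cast hp₂
  have hsum' : (p₁ : ℝ) + p₂ < p₁ * q₂ - p₂ * q₁ := by exact_mod_cast hsum
  have hD : (0 : ℝ) < p₁ * q₂ - p₂ * q₁ := by linarith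
  have hslope : (q₁ : ℝ) / p₁ < q₂ / p₂ := by
    rw [div_lt_div_iff₀ hp₁' hp₂']
    linarith
  have h11 : |(p₁ : ℝ) * 1 - p₂ * 1| < p₁ * q₂ - p₂ * q₁ := by
    rw [abs_lt]; constructor <;> linarith
  have hpos : 0 < q₂ → ∃ κ : ℝ, q₁ < κ * p₁ ∧ κ * p₂ < q₂ ∧ 0 < κ := fun h => by
    have h' : (0 : ℝ) < q₂ / p₂ := div_pos (by exact_mod_cast h) hp₂'
    obtain ⟨κ, h₁, h₂⟩ := exists_between (max_lt hslope h')
    exact ⟨κ, (div_lt_iff₀ hp₁').mp ((le_max_left _ _).trans_lt h₁), (lt_div_iff₀ hp₂').mp h₂,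
      (le_max_right _ _).trans_lt h₁⟩
  have hneg : q₁ < 0 → ∃ κ : ℝ, q₁ < κ * p₁ ∧ κ * p₂ < q₂ ∧ κ < 0 := fun h => by
    have h' : (q₁ : ℝ) / p₁ < 0 := div_neg_of_neg_of_pos (by exact_mod_cast h) hp₁'
    obtain ⟨κ, h₁, h₂⟩ := exists_between (lt_min hslope h')
    exact ⟨κ, (div_lt_iff₀ hp₁').mp h₁, (lt_div_iff₀ hp₂').mp (h₂.trans_le (min_le_left _ _)),
      h₂.trans_le (min_le_right _ _)⟩
  have via₁ : ∀ κ : ℝ, q₁ < κ * p₁ → |q₂| ≤ |q₁| → 0 < κ * q₁ →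
      ShearedGraphJoined κ U (0, 0) (linePoint p₁ q₁ p₂ q₂ 1 1) := fun κ hκ hle hκq => by
    have hq : 1 < |q₁| := by
      nlinarith [mul_le_mul_of_nonneg_left ((le_abs_self q₂).trans hle) hp₁.le,
        mul_le_mul_of_nonneg_left (neg_le_abs q₁) hp₂.le]
    have hq' : (1 : ℝ) < |(q₁ : ℝ)| := by exact_mod_cast hq
    have hle' : |(q₂ : ℝ)| ≤ |(q₁ : ℝ)| := by exact_mod_cast hle
    have hq0 : (q₁ : ℝ) ≠ 0 := by rintro h; simp [h] at hκq
    have hs : |(q₁ : ℝ)⁻¹| < 1 := by rw [abs_inv]; exact inv_lt_one_of_one_lt₀ hq'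
    have hax := hU.joined_axis (κ := κ) hs (by
      rw [← div_eq_mul_inv, div_pos_iff]
      exact mul_pos_iff.mp hκq)
    rw [← linePoint_axis hD, mul_inv_cancel₀ hq0] at hax
    have hb : |(q₂ : ℝ) * (q₁ : ℝ)⁻¹| ≤ 1 := by
      rw [← div_eq_mul_inv, abs_div]
      exact div_le_one_of_le₀ hle' (abs_nonneg _)
    refine hax.trans ?_
    have := hU.joined_up (κ := κ) hD hκ 1 (fun _ => odd_one) (v' := 1) (abs_le.mp hb).2 ?_ ?_
    · simpa using this
    · have : (p₁ : ℝ) * (q₂ * (q₁ : ℝ)⁻¹) - p₂ * (1 : ℤ) =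
          (p₁ * q₂ - p₂ * q₁) * (q₁ : ℝ)⁻¹ := by field_simp; simp
      rw [this, abs_mul, abs_of_pos hD]
      exact mul_lt_of_lt_one_right hD hs
    · simpa using h11
  have via₂ : ∀ κ : ℝ, κ * p₂ < q₂ → |q₁| ≤ |q₂| → 0 < κ * q₂ →
      ShearedGraphJoined κ U (0, 0) (linePoint p₁ q₁ p₂ q₂ 1 1) := fun κ hκ hle hκq => by
    have hq : 1 < |q₂| := by
      nlinarith [mul_le_mul_of_nonneg_left (le_abs_self q₂) hp₁.le,
        mul_le_mul_of_nonneg_left ((neg_le_abs q₁).trans hle) hp₂.le]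
    have hq' : (1 : ℝ) < |(q₂ : ℝ)| := by exact_mod_cast hq
    have hle' : |(q₁ : ℝ)| ≤ |(q₂ : ℝ)| := by exact_mod_cast hle
    have hq0 : (q₂ : ℝ) ≠ 0 := by rintro h; simp [h] at hκq
    have hs : |(q₂ : ℝ)⁻¹| < 1 := by rw [abs_inv]; exact inv_lt_one_of_one_lt₀ hq'
    have hax := hU.joined_axis (κ := κ) hs (by
      rw [← div_eq_mul_inv, div_pos_iff]
      exact mul_pos_iff.mp hκq)
    rw [← linePoint_axis hD, mul_inv_cancel₀ hq0] at hax
    have hb : |(q₁ : ℝ) * (q₂ : ℝ)⁻¹| ≤ 1 := by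
      rw [← div_eq_mul_inv, abs_div]
      exact div_le_one_of_le₀ hle' (abs_nonneg _)
    refine hax.trans ?_
    have := hU.joined_down (κ := κ) hD hκ 1 (fun _ => odd_one) (u' := 1) (abs_le.mp hb).2 ?_ ?_
    · simpa using this
    · have : (p₁ : ℝ) * (1 : ℤ) - p₂ * (q₁ * (q₂ : ℝ)⁻¹) =
          (p₁ * q₂ - p₂ * q₁) * (q₂ : ℝ)⁻¹ := by field_simp; simp
      rw [this, abs_mul, abs_of_pos hD]
      exact mul_lt_of_lt_one_right hD hs
    · simpa using h11
  have hsign : 0 < q₁ → 0 < q₂ := fun h => by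
    by_contra! h'
    nlinarith [mul_pos hp₂ h, mul_nonneg hp₁.le (neg_nonneg.mpr h')]
  have hsign' : q₂ < 0 → q₁ < 0 := fun h => by
    by_contra! h'
    nlinarith [mul_nonneg hp₂.le h', mul_pos hp₁ (neg_pos.mpr h)]
  have hne : ¬ (q₁ = 0 ∧ q₂ = 0) := by
    rintro ⟨rfl, rfl⟩
    simp at hsum
    omega
  rcases le_total |q₁| |q₂| with hle | hle
  · have hq0 : q₂ ≠ 0 := by
      rintro rfl
      exact hne ⟨by simpa using hle, rfl⟩
    rcases hq0.lt_or_gt with h | h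
    · obtain ⟨κ, h₁, h₂, h₃⟩ := hneg (hsign' h)
      exact ⟨κ, h₁, h₂, via₂ κ h₂ hle (mul_pos_of_neg_of_neg h₃ (by exact_mod_cast h))⟩
    · obtain ⟨κ, h₁, h₂, h₃⟩ := hpos h
      exact ⟨κ, h₁, h₂, via₂ κ h₂ hle (mul_pos h₃ (by exact_mod_cast h))⟩
  · have hq0 : q₁ ≠ 0 := by
      rintro rfl
      exact hne ⟨rfl, by simpa using hle⟩
    rcases hq0.lt_or_gt with h | h
    · obtain ⟨κ, h₁, h₂, h₃⟩ := hneg h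
      exact ⟨κ, h₁, h₂, via₁ κ h₁ hle (mul_pos_of_neg_of_neg h₃ (by exact_mod_cast h))⟩
    · obtain ⟨κ, h₁, h₂, h₃⟩ := hpos (hsign h)
      exact ⟨κ, h₁, h₂, via₁ κ h₁ hle (mul_pos h₃ (by exact_mod_cast h))⟩

end Lines

/-- The spacing `m` of the admissible levels of a numerator `p`, the first admissible level `e`,
and the number `n` of gaps between the levels `e` and `p - e`. -/
lemma exists_level_spacing (p : ℤ) (hp : 0 < p) :
    ∃ (m e : ℤ) (n : ℕ), m = (if Even p then 2 else 1) ∧ p = 2 * e + m * n ∧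
      (Even p ∧ e = 1 ∨ ¬ Even p ∧ e = 0) ∧ 0 < m ∧
      ∀ k, (Even p → Odd k) → (Even p → Odd (k + m)) := by
  by_cases h : Even p
  · obtain ⟨c, hc⟩ := id h
    refine ⟨2, 1, (c - 1).toNat, by simp [h], by omega, .inl ⟨h, rfl⟩, two_pos, fun k hk h' => ?_⟩
    exact (hk h').add_even even_two
  · exact ⟨1, 0, p.toNat, by simp [h], by omega, .inr ⟨h, rfl⟩, one_pos,
      fun k _ h' => absurd h' h⟩

lemma ContainsLines.exists_joined {p₁ q₁ p₂ q₂ : ℤ} {U : Set (ℝ × ℝ)}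
    (hU : ContainsLines p₁ q₁ p₂ q₂ U) (hp₁ : 0 < p₁) (hp₂ : 0 < p₂)
    (hsum : p₁ * (if Even p₂ then 2 else 1) + p₂ * (if Even p₁ then 2 else 1) <
      2 * (p₁ * q₂ - p₂ * q₁)) :
    ∃ κ : ℝ, ShearedGraphJoined κ U (0, 0) (π, 0) := by
  obtain ⟨m₁, e₁, n₁, hm₁, hn₁, he₁, hm₁pos, hk₁⟩ := exists_level_spacing p₁ hp₁
  obtain ⟨m₂, e₂, n₂, hm₂, hn₂, he₂, hm₂pos, hk₂⟩ := exists_level_spacing p₂ hp₂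
  have hp₁' : (0 : ℝ) < p₁ := by exact_mod_cast hp₁
  have hp₂' : (0 : ℝ) < p₂ := by exact_mod_cast hp₂
  have hDZ : 0 < p₁ * q₂ - p₂ * q₁ := by
    have : 0 < p₁ * m₂ := by positivity
    have : 0 < p₂ * m₁ := by positivity
    rw [← hm₁, ← hm₂] at hsum
    linarith
  have hD : (0 : ℝ) < p₁ * q₂ - p₂ * q₁ := by exact_mod_cast hDZ
  have hslope : ∃ κ : ℝ, q₁ < κ * p₁ ∧ κ * p₂ < q₂ := by
    have h : (q₁ : ℝ) / p₁ < q₂ / p₂ := by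
      rw [div_lt_div_iff₀ hp₁' hp₂']
      linarith
    obtain ⟨κ, h₁, h₂⟩ := exists_between h
    exact ⟨κ, (div_lt_iff₀ hp₁').mp h₁, (lt_div_iff₀ hp₂').mp h₂⟩
  have hzero : linePoint p₁ q₁ p₂ q₂ 0 0 = (0, 0) := by simp [linePoint]
  have hstart : |p₁ * e₂ - p₂ * e₁| < p₁ * q₂ - p₂ * q₁ ∧ ∃ κ : ℝ, q₁ < κ * p₁ ∧ κ * p₂ < q₂ ∧
      ShearedGraphJoined κ U (0, 0) (linePoint p₁ q₁ p₂ q₂ e₁ e₂) := by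
    rcases he₁ with ⟨h₁, rfl⟩ | ⟨h₁, rfl⟩ <;> rcases he₂ with ⟨h₂, rfl⟩ | ⟨h₂, rfl⟩ <;>
      simp only [h₁, h₂, if_true, if_false] at hsum
    · refine ⟨by rw [abs_lt]; constructor <;> linarith, ?_⟩
      simpa using hU.exists_joined_one_one hp₁ hp₂ (by linarith)
    · have hlt : |p₁ * (0 : ℤ) - p₂ * 1| < p₁ * q₂ - p₂ * q₁ := by
        rw [abs_lt]; constructor <;> linarith
      obtain ⟨κ, hκ₁, hκ₂⟩ := hslope
      refine ⟨hlt, κ, hκ₁, hκ₂, ?_⟩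
      have := hU.joined_down (u := 0) (u' := 1) hD hκ₂ 0 (fun h => absurd h h₂) zero_le_one
        (by simpa using hD) (by exact_mod_cast hlt)
      simpa [hzero] using this
    · have hlt : |p₁ * (1 : ℤ) - p₂ * 0| < p₁ * q₂ - p₂ * q₁ := by
        rw [abs_lt]; constructor <;> linarith
      obtain ⟨κ, hκ₁, hκ₂⟩ := hslope
      refine ⟨hlt, κ, hκ₁, hκ₂, ?_⟩
      have := hU.joined_up (v := 0) (v' := 1) hD hκ₁ 0 (fun h => absurd h h₁) zero_le_one
        (by simpa using hD) (by exact_mod_cast hlt)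
      simpa [hzero] using this
    · obtain ⟨κ, hκ₁, hκ₂⟩ := hslope
      refine ⟨by simpa using hDZ, κ, hκ₁, hκ₂, ?_⟩
      simp only [Int.cast_zero, hzero]
      exact .refl (hU.axis 0 (by simpa using pi_pos))
  rw [← hm₁, ← hm₂] at hsum
  obtain ⟨hlt, κ, hκ₁, hκ₂, hfirst⟩ := hstart
  have hlast := hfirst.reflect hU.reflect
  have hend : ((π - (linePoint p₁ q₁ p₂ q₂ e₁ e₂).1, -(linePoint p₁ q₁ p₂ q₂ e₁ e₂).2) : ℝ × ℝ) =
      linePoint p₁ q₁ p₂ q₂ ((e₁ + m₁ * n₁ : ℤ)) ((e₂ + m₂ * n₂ : ℤ)) := by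
    have h₁ : e₁ + m₁ * n₁ = p₁ - e₁ := by linarith
    have h₂ : e₂ + m₂ * n₂ = p₂ - e₂ := by linarith
    have := hD.ne'
    rw [h₁, h₂]
    simp only [linePoint]
    push_cast
    ext
    · simp only
      rw [eq_div_iff this, sub_mul, div_mul_cancel₀ _ this]
      ring
    · simp only
      rw [eq_div_iff this, neg_mul, div_mul_cancel₀ _ this]
      ring
  rw [hend] at hlast
  simp only [sub_zero, neg_zero] at hlast
  refine ⟨κ, hfirst.trans (.trans ?_ hlast)⟩
  refine lattice_walk
    (fun w w' => ShearedGraphJoined κ U (linePoint p₁ q₁ p₂ q₂ w.1 w.2)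
      (linePoint p₁ q₁ p₂ q₂ w'.1 w'.2))
    p₁ p₂ m₁ m₂ (p₁ * q₂ - p₂ * q₁) hp₁ hp₂ hm₁pos hm₂pos hsum
    (fun w => (Even p₁ → Odd w.1) ∧ (Even p₂ → Odd w.2))
    (fun w hw => ⟨hk₁ _ hw.1, hw.2⟩) (fun w hw => ⟨hw.1, hk₂ _ hw.2⟩) ?_
    (fun a b c => ShearedGraphJoined.trans) ?_ ?_ _ n₂ n₁ rfl (e₁, e₂) ?_ hlt ?_
  · intro w hw h
    exact hU.joined_up hD hκ₁ w.1 hw.1 le_rfl (by exact_mod_cast h) (by exact_mod_cast h)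
  · intro w hw h h'
    exact hU.joined_up hD hκ₁ w.1 hw.1 (by push_cast; linarith [(Int.cast_pos (R := ℝ)).mpr hm₂pos])
      (by exact_mod_cast h) (by exact_mod_cast h')
  · intro w hw h h'
    exact hU.joined_down hD hκ₂ w.2 hw.2
      (by push_cast; linarith [(Int.cast_pos (R := ℝ)).mpr hm₁pos])
      (by exact_mod_cast h) (by exact_mod_cast h')
  · constructor
    · rcases he₁ with ⟨_, rfl⟩ | ⟨h, rfl⟩
      · exact fun _ => odd_one
      · exact fun h' => absurd h' h
    · rcases he₂ with ⟨_, rfl⟩ | ⟨h, rfl⟩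
      · exact fun _ => odd_one
      · exact fun h' => absurd h' h
  · have : p₁ * (e₂ + m₂ * n₂) - p₂ * (e₁ + m₁ * n₁) = -(p₁ * e₂ - p₂ * e₁) := by
      linear_combination (-p₁) * hn₂ + p₂ * hn₁
    rw [this, abs_neg]
    exact hlt

/-- A path in an open symmetric subset of the strip `|y| < π` that joins `(0, 0)` to `(π, 0)` and
is a graph after a linear shear can be replaced by the sheared graph of a smooth odd periodic
function. -/
lemma ShearedGraphJoined.exists_smooth {κ : ℝ} {U : Set (ℝ × ℝ)} (hopen : IsOpen U)
    (hstrip : ∀ x ∈ U, |x.2| < π) (hneg : ∀ θ y, (θ, y) ∈ U → (-θ, -y) ∈ U)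
    (hper : ∀ θ y, (θ, y) ∈ U → (θ + 2 * π, y) ∈ U)
    (h : ShearedGraphJoined κ U (0, 0) (π, 0)) :
    ∃ g₁ g₂ : ℝ → ℝ, ContDiff ℝ (⊤ : ℕ∞) g₁ ∧ ContDiff ℝ (⊤ : ℕ∞) g₂ ∧
      (∀ x, g₁ (-x) = -g₁ x) ∧ (∀ x, g₂ (-x) = -g₂ x) ∧
      Function.Periodic g₁ (2 * π) ∧ Function.Periodic g₂ (2 * π) ∧
      ∀ x, (x - g₁ (g₂ x), g₂ x) ∈ U := by
  obtain ⟨-, f, hf, hf0, hfpi, hfU⟩ := h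
  simp only [mul_zero, add_zero] at hf0 hfpi hfU
  have hpi := pi_pos
  have hγ : Continuous fun x => (x - κ * f x, f x) := by fun_prop
  obtain ⟨δ, hδ, hthick⟩ := ((isCompact_Icc (a := (0 : ℝ)) (b := π)).image
    hγ).exists_thickening_subset_open hopen (by rintro _ ⟨x, hx, rfl⟩; exact hfU x hx)
  have hnear : ∀ x ∈ Set.Icc 0 π, ∀ a b : ℝ, |a - (x - κ * f x)| < δ → |b - f x| < δ →
      (a, b) ∈ U := fun x hx a b ha hb => hthick <| by
    rw [Metric.mem_thickening_iff]
    exact ⟨_, ⟨x, hx, rfl⟩, by rw [Prod.dist_eq]; exact max_lt ha hb⟩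
  obtain ⟨x₀, hx₀, hmax⟩ := (isCompact_Icc (a := (0 : ℝ)) (b := π)).exists_isMaxOn
    ⟨0, le_rfl, hpi.le⟩ hf.abs.continuousOn
  have hM : |f x₀| < π := hstrip _ (hfU x₀ hx₀)
  obtain ⟨M, hM₀, hMpi⟩ := exists_between hM
  have hMpos : 0 < M := (abs_nonneg _).trans_lt hM₀
  have hMsub : 0 < π - M := sub_pos.mpr hMpi
  obtain ⟨g₁, hg₁, hodd₁, hper₁, hnear₁⟩ := exists_smooth_odd_periodic_near
    (fun y => κ * min y (M / (π - M) * (π - y))) (by fun_prop)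
    (by simp; right; positivity) (by simp [hpi.le]) (half_pos hδ)
  have hlin : ∀ y, |y| ≤ M → |g₁ y - κ * y| < δ / 2 := by
    have hnonneg : ∀ y, 0 ≤ y → y ≤ M → |g₁ y - κ * y| < δ / 2 := fun y h0 h1 => by
      have := hnear₁ y ⟨h0, h1.trans hMpi.le⟩
      rwa [min_eq_left] at this
      rw [div_mul_eq_mul_div, le_div_iff₀ hMsub]
      nlinarith
    intro y hy
    rcases le_total 0 y with h | h
    · exact hnonneg y h ((le_abs_self y).trans hy)
    · have := hnonneg (-y) (by linarith) ((neg_le_abs y).trans hy)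
      rw [hodd₁] at this
      rw [← abs_neg]
      convert this using 2
      ring
  have hκ : 0 < |κ| + 1 := by positivity
  obtain ⟨g₂, hg₂, hodd₂, hper₂, hnear₂⟩ := exists_smooth_odd_periodic_near f hf hf0 hfpi
    (δ := min (M - |f x₀|) (δ / 2 / (|κ| + 1))) (lt_min (by linarith) (by positivity))
  refine ⟨g₁, g₂, hg₁, hg₂, hodd₁, hodd₂, hper₁, hper₂, ?_⟩
  have hhalf : ∀ x ∈ Set.Icc 0 π, (x - g₁ (g₂ x), g₂ x) ∈ U := fun x hx => by
    obtain ⟨h₁, h₂⟩ := lt_min_iff.mp (hnear₂ x hx)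
    rw [lt_div_iff₀ hκ] at h₂
    have hfx : |f x| ≤ |f x₀| := hmax hx
    have hyM : |g₂ x| ≤ M := by
      have := abs_sub_abs_le_abs_sub (g₂ x) (f x)
      linarith
    have hl := hlin _ hyM
    have hnn := abs_nonneg (g₂ x - f x)
    have hκn := mul_nonneg hnn (abs_nonneg κ)
    refine hnear x hx _ _ ?_ (by linarith)
    have e : x - g₁ (g₂ x) - (x - κ * f x) = -((g₁ (g₂ x) - κ * g₂ x) + κ * (g₂ x - f x)) := by
      ring
    rw [e, abs_neg]
    refine (abs_add_le _ _).trans_lt ?_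
    rw [abs_mul]
    linarith
  have hfull : ∀ x ∈ Set.Icc (-π) π, (x - g₁ (g₂ x), g₂ x) ∈ U := fun x hx => by
    rcases le_total 0 x with h | h
    · exact hhalf x ⟨h, hx.2⟩
    · have := hneg _ _ (hhalf (-x) ⟨by linarith, by linarith [hx.1]⟩)
      rw [hodd₂, hodd₁] at this
      convert this using 2 <;> ring
  have hP : Function.Periodic (fun x => (x - g₁ (g₂ x), g₂ x) ∈ U) (2 * π) := fun x => by
    simp only [hper₂ x, eq_iff_iff]
    refine ⟨fun h => ?_, fun h => ?_⟩
    · have := hneg _ _ (hper _ _ (hneg _ _ h))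
      convert this using 2 <;> ring
    · convert hper _ _ h using 2
      ring
  intro x
  obtain ⟨y, hy, hxy⟩ := hP.exists_mem_Ico (by positivity) x (-π)
  rw [show ((x - g₁ (g₂ x), g₂ x) ∈ U) = _ from hxy]
  exact hfull y ⟨hy.1, by linarith [hy.2]⟩

namespace ContainsLines

variable {p₁ q₁ p₂ q₂ : ℤ} {U : Set (ℝ × ℝ)}

lemma swap (hU : ContainsLines p₁ q₁ p₂ q₂ U) : ContainsLines p₂ q₂ p₁ q₁ U :=
  ⟨hU.reflect, hU.line₂, hU.line₁, hU.axis⟩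

lemma neg_first (hU : ContainsLines p₁ q₁ p₂ q₂ U) : ContainsLines (-p₁) (-q₁) p₂ q₂ U := by
  refine ⟨hU.reflect, fun θ y hy k hk hodd => hU.line₁ θ y hy (-k) ?_ ?_, hU.line₂, hU.axis⟩
  · push_cast at hk ⊢
    linarith
  · simpa using hodd

lemma exists_joined_of_ne (hU : ContainsLines p₁ q₁ p₂ q₂ U) (hp₁ : p₁ ≠ 0) (hp₂ : p₂ ≠ 0)
    (hD : p₁ * q₂ - p₂ * q₁ ≠ 0)
    (hsum : |p₁| * (if Even p₂ then 2 else 1) + |p₂| * (if Even p₁ then 2 else 1) <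
      2 * |p₁ * q₂ - p₂ * q₁|) :
    ∃ κ : ℝ, ShearedGraphJoined κ U (0, 0) (π, 0) := by
  wlog h₁ : 0 < p₁ generalizing p₁ q₁
  · refine this hU.neg_first (neg_ne_zero.mpr hp₁) ?_ ?_ (by omega)
    · contrapose! hD
      linarith
    · rw [show -p₁ * q₂ - p₂ * -q₁ = -(p₁ * q₂ - p₂ * q₁) by ring]
      simpa only [abs_neg, even_neg] using hsum
  wlog h₂ : 0 < p₂ generalizing p₂ q₂
  · refine this (neg_ne_zero.mpr hp₂) hU.swap.neg_first.swap ?_ ?_ (by omega)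
    · contrapose! hD
      linarith
    · rw [show p₁ * -q₂ - -p₂ * q₁ = -(p₁ * q₂ - p₂ * q₁) by ring]
      simpa only [abs_neg, even_neg] using hsum
  rw [abs_of_pos h₁, abs_of_pos h₂] at hsum
  rcases hD.lt_or_gt with h | h
  · rw [abs_of_neg h] at hsum
    exact hU.swap.exists_joined h₂ h₁ (by linarith)
  · rw [abs_of_pos h] at hsum
    exact hU.exists_joined h₁ h₂ hsum

end ContainsLines

lemma mem_Spq_add_pi {p q : ℤ} (hc : IsCoprime p q) {θ y : ℝ} {k : ℤ}
    (h : p * θ + q * y = π * k) (hk : Even p → Odd k) : (θ, y + π) ∈ Spq p q := by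
  rcases Int.even_or_odd (k + q) with ⟨c, hc'⟩ | hodd
  · have hc'' : (k : ℝ) + q = c + c := by exact_mod_cast hc'
    exact .inl ⟨c, by linear_combination h + π * hc''⟩
  · have hp : Odd p := by
      by_contra hp
      rw [Int.not_odd_iff_even] at hp
      have hq : Odd q := by
        by_contra hq
        rw [Int.not_odd_iff_even] at hq
        have := hc.isUnit_of_dvd' hp.two_dvd hq.two_dvd
        rw [Int.isUnit_iff] at this
        omega
      exact Int.not_even_iff_odd.mpr hodd ((hk hp).add_odd hq)
    obtain ⟨c, hc'⟩ := hodd.add_odd hp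
    have hc'' : (k : ℝ) + q + p = c + c := by exact_mod_cast hc'
    exact .inr ⟨c, by linear_combination h + π * hc''⟩

lemma ne_two_pi_mul_int {y : ℝ} (hy : |y| < π) (k : ℤ) : y + π ≠ 2 * π * k := by
  intro h
  have hpi := pi_pos
  rw [abs_lt] at hy
  have h0 : (0 : ℝ) < k := by
    by_contra! h0
    nlinarith
  have h1 : (k : ℝ) < 1 := by
    by_contra! h1
    nlinarith
  have h0' : 0 < k := by exact_mod_cast h0
  have h1' : k < 1 := by exact_mod_cast h1
  omega

lemma abs_sum_lt_of_dd {p₁ q₁ p₂ q₂ : ℤ} (hD : p₁ * q₂ - p₂ * q₁ ≠ 0)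
    (hd : dd p₁ q₁ p₂ q₂ + dd p₂ q₂ p₁ q₁ < 2 * π) :
    |p₁| * (if Even p₂ then 2 else 1) + |p₂| * (if Even p₁ then 2 else 1) <
      2 * |p₁ * q₂ - p₂ * q₁| := by
  have hdd : ∀ a b c d : ℤ, dd a b c d =
      π * (((|a| * (if Even c then 2 else 1) : ℤ) : ℝ) / ((|a * d - c * b| : ℤ) : ℝ)) := by
    intro a b c d
    unfold dd
    split_ifs <;> push_cast <;> ring
  have hpos : (0 : ℝ) < ((|p₁ * q₂ - p₂ * q₁| : ℤ) : ℝ) := by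
    exact_mod_cast abs_pos.mpr hD
  rw [hdd, hdd, show |p₂ * q₁ - p₁ * q₂| = |p₁ * q₂ - p₂ * q₁| from abs_sub_comm _ _, ← mul_add,
    mul_comm 2 π, mul_lt_mul_iff_right₀ pi_pos, ← add_div, div_lt_iff₀ hpos] at hd
  exact_mod_cast hd

/-- Geometric core of the proof of the main theorem.  If `r₁ ≠ r₂` with `|r₁|, |r₂| > 2`
and `d₁ + d₂ < 2π`, and `C` is a closed set which is invariant under `(θ,η) ↦ (θ+π,η)`
and `(θ,η) ↦ (θ,η+2π)`, meets an `ε`-neighbourhood of the vertical lines `θ ∈ πℤ` only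
at heights `η ∈ 2πℤ`, and meets `S(r₁) ∪ S(r₂)` only at heights `η ∈ 2πℤ`, then there are
smooth odd `2π`-periodic functions `g₁, g₂` with `|g₂| < π` such that the sheared and
shifted copy of `C` avoids the graph of `g₂`. -/
theorem statement_12 (p₁ q₁ p₂ q₂ : ℤ) (hq₁ : q₁ ≠ 0) (hq₂ : q₂ ≠ 0)
    (hc₁ : IsCoprime p₁ q₁) (hc₂ : IsCoprime p₂ q₂)
    (hne : p₁ * q₂ ≠ p₂ * q₁)
    (hr₁ : 2 < |(p₁ : ℝ) / q₁|) (hr₂ : 2 < |(p₂ : ℝ) / q₂|)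
    (hd : dd p₁ q₁ p₂ q₂ + dd p₂ q₂ p₁ q₁ < 2 * π)
    (C : Set (ℝ × ℝ)) (hC : IsClosed C)
    (hinv₁ : ∀ x : ℝ × ℝ, x ∈ C ↔ (x.1 + π, x.2) ∈ C)
    (hinv₂ : ∀ x : ℝ × ℝ, x ∈ C ↔ (x.1, x.2 + 2 * π) ∈ C)
    (hvert : ∃ ε > 0, ∀ x ∈ C, (∃ k : ℤ, |x.1 - (k : ℝ) * π| ≤ ε) →
      ∃ k : ℤ, x.2 = 2 * π * (k : ℝ))
    (hS : ∀ x ∈ C ∩ (Spq p₁ q₁ ∪ Spq p₂ q₂), ∃ k : ℤ, x.2 = 2 * π * (k : ℝ)) :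
    ∃ g₁ g₂ : ℝ → ℝ, ContDiff ℝ (⊤ : ℕ∞) g₁ ∧ ContDiff ℝ (⊤ : ℕ∞) g₂ ∧
      (∀ x, g₁ (-x) = -g₁ x) ∧ (∀ x, g₂ (-x) = -g₂ x) ∧
      Function.Periodic g₁ (2 * π) ∧ Function.Periodic g₂ (2 * π) ∧
      (∀ x, |g₂ x| < π) ∧
      ∀ x ∈ C, x.2 - π ≠ g₂ (x.1 + g₁ (x.2 - π)) := by
  have hpi := pi_pos
  have hp₁ : p₁ ≠ 0 := by rintro rfl; norm_num at hr₁
  have hp₂ : p₂ ≠ 0 := by rintro rfl; norm_num at hr₂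
  have hD : p₁ * q₂ - p₂ * q₁ ≠ 0 := sub_ne_zero.mpr hne
  have hline₁ : ∀ θ y, |y| < π → ∀ k : ℤ, p₁ * θ + q₁ * y = π * k → (Even p₁ → Odd k) →
      (θ, y + π) ∉ C := fun θ y hy k hk hodd hmem => by
    obtain ⟨n, hn⟩ := hS _ ⟨hmem, .inl (mem_Spq_add_pi hc₁ hk hodd)⟩
    exact ne_two_pi_mul_int hy n hn
  have hline₂ : ∀ θ y, |y| < π → ∀ k : ℤ, p₂ * θ + q₂ * y = π * k → (Even p₂ → Odd k) →
      (θ, y + π) ∉ C := fun θ y hy k hk hodd hmem => by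
    obtain ⟨n, hn⟩ := hS _ ⟨hmem, .inr (mem_Spq_add_pi hc₂ hk hodd)⟩
    exact ne_two_pi_mul_int hy n hn
  have haxis : ∀ y, |y| < π → (0, y + π) ∉ C := fun y hy hmem => by
    obtain ⟨ε, hε, hv⟩ := hvert
    obtain ⟨n, hn⟩ := hv _ hmem ⟨0, by simpa using hε.le⟩
    exact ne_two_pi_mul_int hy n hn
  let U : Set (ℝ × ℝ) := {x | |x.2| < π ∧ (x.1, x.2 + π) ∉ C ∧ (-x.1, -x.2 + π) ∉ C}
  have hU : ContainsLines p₁ q₁ p₂ q₂ U := by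
    refine ⟨fun θ y h => ⟨by simpa using h.1, ?_, ?_⟩,
      fun θ y hy k hk hodd => ⟨hy, hline₁ θ y hy k hk hodd,
        hline₁ _ _ (by simpa using hy) (-k) (by push_cast; linarith) (by simpa using hodd)⟩,
      fun θ y hy k hk hodd => ⟨hy, hline₂ θ y hy k hk hodd,
        hline₂ _ _ (by simpa using hy) (-k) (by push_cast; linarith) (by simpa using hodd)⟩,
      fun y hy => ⟨hy, haxis y hy, by simpa using haxis (-y) (by simpa using hy)⟩⟩
    · intro hmem
      refine h.2.2 ((hinv₁ _).mpr ?_)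
      convert hmem using 2
      ring
    · intro hmem
      refine h.2.1 ?_
      have := (hinv₁ _).mp hmem
      convert this using 2
      · ring
      · ring
  have hopen : IsOpen U := by
    refine (isOpen_lt (f := fun x : ℝ × ℝ => |x.2|) (by fun_prop) continuous_const).inter (IsOpen.inter ?_ ?_)
    · exact hC.isOpen_compl.preimage (f := fun x : ℝ × ℝ => (x.1, x.2 + π)) (by fun_prop)
    · exact hC.isOpen_compl.preimage (f := fun x : ℝ × ℝ => (-x.1, -x.2 + π)) (by fun_prop)
  obtain ⟨κ, hκ⟩ := hU.exists_joined_of_ne hp₁ hp₂ hD (abs_sum_lt_of_dd hD hd)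
  have hneg : ∀ θ y, (θ, y) ∈ U → (-θ, -y) ∈ U := fun θ y h =>
    ⟨by simpa using h.1, h.2.2, by simpa using h.2.1⟩
  have hshift : ∀ θ y, (θ, y) ∈ U → (θ + π, y) ∈ U := fun θ y h => by
    have := hU.reflect _ _ (hneg θ y h)
    convert this using 2 <;> ring
  obtain ⟨g₁, g₂, hg₁, hg₂, hodd₁, hodd₂, hper₁, hper₂, hgraph⟩ :=
    hκ.exists_smooth hopen (fun x hx => hx.1) hneg (fun θ y h => by
      convert hshift _ _ (hshift θ y h) using 2
      ring)
  refine ⟨g₁, g₂, hg₁, hg₂, hodd₁, hodd₂, hper₁, hper₂, fun x => (hgraph x).1,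
    fun x hx heq => ?_⟩
  have h := (hgraph (x.1 + g₁ (x.2 - π))).2.1
  rw [← heq] at h
  exact h (by simpa using hx)
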